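/- arXiv:math/0601767 — 2 statements merged into one kernel-verified Lean document; each statement's English description precedes it below -/
import Mathlib

section
/- For every ε > 0 there exists N such that for every generic set Y of n ≥ N points in ℝ³, the box graph G_b(Y) has at most (7/16 + ε)·n² edges. -/
open scoped Classical

/-- A finite set in ℝ³ is generic if no two distinct points agree in any coordinate. -/
def Generic3 (Y : Finset (Fin 3 → ℝ)) : Prop :=
  ∀ p ∈ Y, ∀ q ∈ Y, p ≠ q → ∀ i, p i ≠ q i

/-- `p` and `q` span an empty box w.r.t. `Y`: no point of `Y` lies in the open
interior of the axis-aligned box spanned by `p` and `q`. -/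
def SpansEmptyBox (Y : Finset (Fin 3 → ℝ)) (p q : Fin 3 → ℝ) : Prop :=
  ∀ z ∈ Y, ¬ (∀ i, min (p i) (q i) < z i ∧ z i < max (p i) (q i))

/-- Number of edges of the box graph `G_b(Y)`: the number of 2-element subsets of `Y`
whose two points span an empty box. -/
noncomputable def boxEdgeCount (Y : Finset (Fin 3 → ℝ)) : ℕ :=
  ((Y.powersetCard 2).filter
    (fun A => ∀ p ∈ A, ∀ q ∈ A, p ≠ q → SpansEmptyBox Y p q)).card

lemma SpansEmptyBox.symm {Y : Finset (Fin 3 → ℝ)} {p q : Fin 3 → ℝ} (h : SpansEmptyBox Y p q) :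
    SpansEmptyBox Y q p := by
  simpa only [SpansEmptyBox, min_comm, max_comm] using h

lemma SpansEmptyBox.mono {Y Z : Finset (Fin 3 → ℝ)} {p q : Fin 3 → ℝ} (hZ : Z ⊆ Y)
    (h : SpansEmptyBox Y p q) : SpansEmptyBox Z p q :=
  fun z hz => h z (hZ hz)

lemma Generic3.mono {Y Z : Finset (Fin 3 → ℝ)} (hZ : Z ⊆ Y) (h : Generic3 Y) : Generic3 Z :=
  fun p hp q hq => h p (hZ hp) q (hZ hq)

/-- The neighbours of `v` in the box graph of `Y`. -/
noncomputable def boxNeighbors (Y : Finset (Fin 3 → ℝ)) (v : Fin 3 → ℝ) :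
    Finset (Fin 3 → ℝ) :=
  (Y.erase v).filter (SpansEmptyBox Y v)

/-- The edges of the box graph, as two-element sets. -/
noncomputable def boxEdges (Y : Finset (Fin 3 → ℝ)) : Finset (Finset (Fin 3 → ℝ)) :=
  (Y.powersetCard 2).filter
    (fun A => ∀ p ∈ A, ∀ q ∈ A, p ≠ q → SpansEmptyBox Y p q)

lemma mem_boxEdges {Y : Finset (Fin 3 → ℝ)} {A : Finset (Fin 3 → ℝ)} :
    A ∈ boxEdges Y ↔
      (A ⊆ Y ∧ A.card = 2) ∧ ∀ p ∈ A, ∀ q ∈ A, p ≠ q → SpansEmptyBox Y p q := by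
  rw [boxEdges, Finset.mem_filter, Finset.mem_powersetCard]

lemma card_boxEdges (Y : Finset (Fin 3 → ℝ)) : (boxEdges Y).card = boxEdgeCount Y := by
  unfold boxEdges boxEdgeCount
  congr!

lemma boxEdgeCount_le_two_pow (Y : Finset (Fin 3 → ℝ)) : boxEdgeCount Y ≤ 2 ^ Y.card := by
  rw [← card_boxEdges, ← Finset.card_powerset]
  exact Finset.card_le_card fun A hA => Finset.mem_powerset.2 (mem_boxEdges.1 hA).1.1

/-- Deleting `v` destroys only the edges at `v`. -/
lemma boxEdgeCount_le_erase_add (Y : Finset (Fin 3 → ℝ)) (v : Fin 3 → ℝ) :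
    boxEdgeCount Y ≤ boxEdgeCount (Y.erase v) + (boxNeighbors Y v).card := by
  have hsub : boxEdges Y ⊆
      boxEdges (Y.erase v) ∪ (boxNeighbors Y v).image (fun w => {v, w}) := by
    intro A hA
    obtain ⟨⟨hAY, hcard⟩, hE⟩ := mem_boxEdges.1 hA
    by_cases hv : v ∈ A
    · refine Finset.mem_union_right _ (Finset.mem_image.2 ?_)
      obtain ⟨w, hw⟩ := Finset.card_eq_one.1
        (show (A.erase v).card = 1 by rw [Finset.card_erase_of_mem hv, hcard])
      have hwA : w ∈ A.erase v := by simp [hw]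
      obtain ⟨hwv, hwA⟩ := Finset.mem_erase.1 hwA
      refine ⟨w, ?_, ?_⟩
      · simp only [boxNeighbors, Finset.mem_filter, Finset.mem_erase]
        exact ⟨⟨hwv, hAY hwA⟩, hE v hv w hwA hwv.symm⟩
      · rw [← Finset.insert_erase hv, hw]
    · refine Finset.mem_union_left _ (mem_boxEdges.2 ⟨
        ⟨Finset.subset_erase.2 ⟨hAY, hv⟩, hcard⟩, fun p hp q hq hpq => ?_⟩)
      exact (hE p hp q hq hpq).mono (Finset.erase_subset _ _)
  rw [← card_boxEdges, ← card_boxEdges]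
  exact (Finset.card_le_card hsub).trans <| (Finset.card_union_le _ _).trans <|
    Nat.add_le_add_left Finset.card_image_le _

/-- A three-dimensional Erdős–Szekeres theorem: more than `16` points in general position contain
a coordinatewise monotone triple. -/
lemma exists_strictly_between {V : Type*} [Fintype V] (hV : 16 < Fintype.card V)
    (Q : V → Fin 3 → ℝ) (hQ : ∀ i, Function.Injective fun v => Q v i) :
    ∃ p q r : V, p ≠ r ∧ q ≠ p ∧ q ≠ r ∧
      ∀ i, min (Q p i) (Q r i) < Q q i ∧ Q q i < max (Q p i) (Q r i) := by
  let col : V → V → Bool × Bool := fun u v => (decide (Q u 1 < Q v 1), decide (Q u 2 < Q v 2))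
  let out : V → (Bool × Bool → Bool) := fun v c => decide (∃ w, Q v 0 < Q w 0 ∧ col v w = c)
  obtain ⟨u, v, huv, hout⟩ := Fintype.exists_ne_map_eq_of_card_lt out (by simpa using hV)
  wlog hlt : Q u 0 < Q v 0 generalizing u v
  · exact this v u huv.symm hout.symm
      (lt_of_le_of_ne (not_lt.1 hlt) ((hQ 0).ne huv.symm))
  have hu : out u (col u v) = true := decide_eq_true ⟨v, hlt, rfl⟩
  rw [hout] at hu
  obtain ⟨w, hvw, hcol⟩ := of_decide_eq_true hu
  have huw : u ≠ w := by rintro rfl; exact lt_asymm hlt hvw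
  have hwv : v ≠ w := by rintro rfl; exact lt_irrefl _ hvw
  refine ⟨u, v, w, huw, huv.symm, hwv, ?_⟩
  have between : ∀ i, (Q v i < Q w i ↔ Q u i < Q v i) →
      min (Q u i) (Q w i) < Q v i ∧ Q v i < max (Q u i) (Q w i) := by
    intro i hi
    rcases lt_or_gt_of_ne ((hQ i).ne huv) with h | h
    · exact ⟨min_lt_of_left_lt h, lt_max_of_lt_right (hi.2 h)⟩
    · have h' : Q w i < Q v i :=
        lt_of_le_of_ne (not_lt.1 fun h' => lt_asymm h (hi.1 h')) ((hQ i).ne hwv.symm)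
      exact ⟨min_lt_of_right_lt h', lt_max_of_lt_left h⟩
  simp only [col, Prod.mk.injEq, decide_eq_decide] at hcol
  intro i
  fin_cases i
  · exact between 0 ⟨fun _ => hlt, fun _ => hvw⟩
  · exact between 1 hcol.1
  · exact between 2 hcol.2

lemma exists_lt_card_filter_le_le_two {S : Finset ℝ} (hS : 2 ≤ S.card) :
    ∃ a ∈ S, ∃ b ∈ S, a < b ∧ (S.filter (· ≤ b)).card ≤ 2 := by
  have hne : S.Nonempty := Finset.card_pos.1 (by omega)
  have ha := S.min'_mem hne
  have hne' : (S.erase (S.min' hne)).Nonempty :=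
    Finset.card_pos.1 (by rw [Finset.card_erase_of_mem ha]; omega)
  have hb := (S.erase (S.min' hne)).min'_mem hne'
  refine ⟨_, ha, _, Finset.mem_of_mem_erase hb, S.min'_lt_of_mem_erase_min' hne hb, ?_⟩
  refine (Finset.card_le_card (t := {S.min' hne, (S.erase (S.min' hne)).min' hne'}) ?_).trans
    Finset.card_le_two
  intro x hx
  obtain ⟨hxS, hx⟩ := Finset.mem_filter.1 hx
  rw [Finset.mem_insert, Finset.mem_singleton, or_iff_not_imp_left]
  exact fun hxa => le_antisymm hx (Finset.min'_le _ _ (Finset.mem_erase.2 ⟨hxa, hxS⟩))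

/-- Finite sets of reals that are large compared to their number contain pairs spanning
pairwise disjoint intervals. -/
lemma exists_disjoint_intervals {ι : Type*} (I : Finset ι) :
    ∀ S : ι → Finset ℝ, (∀ i ∈ I, 2 * I.card ≤ (S i).card) →
      ∃ a b : ι → ℝ, (∀ i ∈ I, a i ∈ S i ∧ b i ∈ S i ∧ a i < b i) ∧
        ∀ i ∈ I, ∀ j ∈ I, i ≠ j → b i < a j ∨ b j < a i := by
  induction hn : I.card generalizing I with
  | zero =>
    intro S _
    obtain rfl := Finset.card_eq_zero.1 hn
    exact ⟨0, 0, by simp, by simp⟩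
  | succ n ih =>
    intro S hS
    have key : ∀ i, ∃ s : ℝ × ℝ, i ∈ I →
        s.1 ∈ S i ∧ s.2 ∈ S i ∧ s.1 < s.2 ∧ ((S i).filter (· ≤ s.2)).card ≤ 2 := by
      intro i
      by_cases hi : i ∈ I
      · obtain ⟨a, ha, b, hb, hab, h⟩ :=
          exists_lt_card_filter_le_le_two (S := S i) (by have := hS i hi; omega)
        exact ⟨(a, b), fun _ => ⟨ha, hb, hab, h⟩⟩
      · exact ⟨0, fun h => absurd h hi⟩
    choose s hs using key
    obtain ⟨k, hk, hmin⟩ := I.exists_min_image (fun i => (s i).2) (Finset.card_pos.1 (by omega))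
    obtain ⟨a, b, hab, hdisj⟩ := ih (I.erase k) (by rw [Finset.card_erase_of_mem hk, hn]; rfl)
      (fun i => (S i).filter (fun x => ¬ x ≤ (s k).2)) (by
        intro i hi
        have hi := Finset.mem_of_mem_erase hi
        have h1 := Finset.card_filter_add_card_filter_not (s := S i) (fun x => x ≤ (s k).2)
        have h2 : ((S i).filter (· ≤ (s k).2)).card ≤ ((S i).filter (· ≤ (s i).2)).card :=
          Finset.card_le_card
            (Finset.monotone_filter_right _ fun x _ hx => hx.trans (hmin i hi))
        have h3 := (hs i hi).2.2.2
        have h4 := hS i hi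
        omega)
    refine ⟨Function.update a k (s k).1, Function.update b k (s k).2, ?_, ?_⟩
    · intro i hi
      rcases eq_or_ne i k with rfl | hik
      · simpa using ⟨(hs i hi).1, (hs i hi).2.1, (hs i hi).2.2.1⟩
      · have := hab i (Finset.mem_erase.2 ⟨hik, hi⟩)
        simp only [Finset.mem_filter] at this
        simpa [hik] using ⟨this.1.1, this.2.1.1, this.2.2⟩
    · have above : ∀ i ∈ I, i ≠ k → (s k).2 < a i := fun i hi hik =>
        not_le.1 (Finset.mem_filter.1 (hab i (Finset.mem_erase.2 ⟨hik, hi⟩)).1).2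
      intro i hi j hj hij
      rcases eq_or_ne i k with rfl | hik
      · simpa [hij.symm] using Or.inl (above j hj hij.symm)
      · rcases eq_or_ne j k with rfl | hjk
        · simpa [hij] using Or.inr (above i hi hij)
        · simpa [hik, hjk] using
            hdisj i (Finset.mem_erase.2 ⟨hik, hi⟩) j (Finset.mem_erase.2 ⟨hjk, hj⟩) hij

/-- Box graphs contain no complete `9`-partite graph with `18` vertices in each part. -/
lemma exists_not_spansEmptyBox {Y : Finset (Fin 3 → ℝ)} (hY : Generic3 Y)
    (P : Fin 9 × Fin 18 → Fin 3 → ℝ) (hPY : ∀ v, P v ∈ Y) (hP : Function.Injective P) :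
    ∃ v w, v.1 ≠ w.1 ∧ ¬ SpansEmptyBox Y (P v) (P w) := by
  have hinj : ∀ i, Function.Injective fun v => P v i := fun i v w h =>
    by_contra fun hvw => hY _ (hPY v) _ (hPY w) (hP.ne hvw) i h
  obtain ⟨a, b, hab, hdisj⟩ := exists_disjoint_intervals (Finset.univ : Finset (Fin 9))
    (fun i => Finset.univ.image fun j : Fin 18 => P (i, j) 0) (by
      intro i _
      rw [Finset.card_image_of_injective _ fun j k h => (Prod.mk.inj (hinj 0 h)).2]
      simp)
  simp only [Finset.mem_univ, true_and, true_imp_iff, Finset.mem_image] at hab hdisj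
  choose ja jb hlt using fun i => (⟨(hab i).1.choose, (hab i).2.1.choose,
    (hab i).1.choose_spec, (hab i).2.1.choose_spec, (hab i).2.2⟩ :
      ∃ j k, P (i, j) 0 = a i ∧ P (i, k) 0 = b i ∧ a i < b i)
  let σ : Fin 9 × Bool → Fin 9 × Fin 18 := fun v => (v.1, if v.2 then jb v.1 else ja v.1)
  have hne : ∀ i, ja i ≠ jb i := fun i h => by
    obtain ⟨h1, h2, h3⟩ := hlt i
    rw [h, h2] at h1
    exact h3.ne' h1
  have hσ : Function.Injective σ := by
    rintro ⟨i, s⟩ ⟨j, t⟩ h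
    obtain ⟨rfl, h⟩ := Prod.mk.inj h
    cases s <;> cases t <;> simp_all [eq_comm]
  have hx : ∀ v, a v.1 ≤ P (σ v) 0 ∧ P (σ v) 0 ≤ b v.1 := by
    rintro ⟨i, s⟩
    obtain ⟨h1, h2, h3⟩ := hlt i
    cases s
    · simpa [σ, h1] using h3.le
    · simpa [σ, h2] using h3.le
  obtain ⟨p, q, r, hpr, hqp, hqr, hbox⟩ := exists_strictly_between (V := Fin 9 × Bool) (by simp)
    (fun v => P (σ v)) fun i => (hinj i).comp hσ
  by_cases h : p.1 = r.1
  · have hq : q.1 ≠ p.1 := by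
      intro hq
      obtain ⟨p1, p2⟩ := p
      obtain ⟨q1, q2⟩ := q
      obtain ⟨r1, r2⟩ := r
      obtain rfl : p1 = r1 := h
      obtain rfl : q1 = p1 := hq
      revert hpr hqp hqr
      cases p2 <;> cases q2 <;> cases r2 <;> simp
    have hp0 := hx p
    have hq0 := hx q
    have hr0 := hx r
    rw [← h] at hr0
    obtain ⟨h1, h2⟩ := hbox 0
    have h1 := (le_min hp0.1 hr0.1).trans_lt h1
    have h2 := h2.trans_le (max_le hp0.2 hr0.2)
    rcases hdisj _ _ hq with h3 | h3 <;> linarith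
  · exact ⟨σ p, σ r, h, fun hE => hE _ (hPY (σ q)) hbox⟩

/-- Large box graphs have a vertex of relative degree less than `7 / 8 + ε`. -/
lemma exists_card_boxNeighbors_lt {ε : ℝ} (hε : 0 < ε) :
    ∃ N : ℕ, ∀ Y : Finset (Fin 3 → ℝ), Generic3 Y → N ≤ Y.card →
      ∃ v ∈ Y, ((boxNeighbors Y v).card : ℝ) < (7 / 8 + ε) * Y.card := by
  obtain ⟨N, hN⟩ := Filter.eventually_atTop.1
    (SimpleGraph.eventually_completeEquipartiteGraph_isContained_of_minDegree hε 8 18)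
  refine ⟨N + 1, fun Y hY hcard => ?_⟩
  by_contra! hdeg
  let e := Y.equivFin
  let G : SimpleGraph (Fin Y.card) :=
    { Adj := fun i j => i ≠ j ∧ SpansEmptyBox Y (e.symm i) (e.symm j)
      symm := ⟨fun _ _ h => ⟨h.1.symm, h.2.symm⟩⟩
      loopless := ⟨fun _ h => h.1 rfl⟩ }
  have hdegG : ∀ i, (boxNeighbors Y (e.symm i)).card ≤ G.degree i := by
    intro i
    rw [← SimpleGraph.card_neighborFinset_eq_degree]
    refine Finset.card_le_card_of_surjOn (fun j => (e.symm j : Fin 3 → ℝ)) fun w hw => ?_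
    simp only [boxNeighbors, Finset.coe_filter, Finset.mem_erase, Set.mem_ofPred_eq] at hw
    refine ⟨e ⟨w, hw.1.2⟩, ?_, by simp⟩
    simp only [Finset.mem_coe, SimpleGraph.mem_neighborFinset]
    refine ⟨?_, by simpa using hw.2⟩
    intro h
    apply hw.1.1
    simp [h]
  have : Nonempty (Fin Y.card) := Fin.pos_iff_nonempty.1 (by omega)
  obtain ⟨i, hi⟩ := G.exists_minimal_degree_vertex
  obtain ⟨f⟩ := hN Y.card (by omega) (G := G) (by
    have h1 := hdeg _ (e.symm i).2
    have h2 : ((boxNeighbors Y (e.symm i)).card : ℝ) ≤ G.degree i := mod_cast hdegG i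
    rw [hi]
    norm_num
    linarith)
  obtain ⟨v, w, hvw, hbox⟩ := exists_not_spansEmptyBox hY (fun v => (e.symm (f v) : Fin 3 → ℝ))
    (fun v => (e.symm (f v)).2)
    (Subtype.val_injective.comp (e.symm.injective.comp f.injective))
  exact hbox (f.toHom.map_adj (v := v) (w := w) hvw).2

lemma exists_boxEdgeCount_le_add {ε : ℝ} (hε : 0 < ε) :
    ∃ C : ℝ, ∀ Y : Finset (Fin 3 → ℝ), Generic3 Y →
      (boxEdgeCount Y : ℝ) ≤ (7 / 8 + ε) * (Y.card * (Y.card + 1) / 2) + C := by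
  obtain ⟨N, hN⟩ := exists_card_boxNeighbors_lt hε
  refine ⟨(2 : ℝ) ^ N, fun Y => ?_⟩
  induction hn : Y.card generalizing Y with
  | zero =>
    intro _
    have h1 : boxEdgeCount Y ≤ 2 ^ 0 := hn ▸ boxEdgeCount_le_two_pow Y
    have h2 : (boxEdgeCount Y : ℝ) ≤ 1 := mod_cast h1
    simpa using h2.trans (one_le_pow₀ one_le_two)
  | succ n ih =>
    intro hY
    by_cases hcard : N ≤ Y.card
    · obtain ⟨v, hv, hdeg⟩ := hN Y hY hcard
      have h1 := ih (Y.erase v) (by rw [Finset.card_erase_of_mem hv, hn]; rfl)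
        (hY.mono (Finset.erase_subset _ _))
      have h2 : (boxEdgeCount Y : ℝ) ≤ boxEdgeCount (Y.erase v) + (boxNeighbors Y v).card :=
        mod_cast boxEdgeCount_le_erase_add Y v
      rw [hn] at hdeg
      push_cast at hdeg ⊢
      linarith
    · have h1 : boxEdgeCount Y ≤ 2 ^ N :=
        (boxEdgeCount_le_two_pow Y).trans (Nat.pow_le_pow_right two_pos (by omega))
      have h2 : (boxEdgeCount Y : ℝ) ≤ 2 ^ N := mod_cast h1
      have h3 : 0 ≤ (7 / 8 + ε) * (((n + 1 : ℕ) : ℝ) * ((n + 1 : ℕ) + 1) / 2) := by positivity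
      linarith

theorem boxGraph_edges_upper (ε : ℝ) (hε : 0 < ε) :
    ∃ N : ℕ, ∀ Y : Finset (Fin 3 → ℝ), Generic3 Y → N ≤ Y.card →
      (boxEdgeCount Y : ℝ) ≤ (7 / 16 + ε) * (Y.card : ℝ) ^ 2 := by
  obtain ⟨C, hC⟩ := exists_boxEdgeCount_le_add hε
  refine ⟨⌈(2 * |C| + 7 / 8 + ε) / ε⌉₊ + 1, fun Y hY hcard => (hC Y hY).trans ?_⟩
  have h1 : (1 : ℝ) ≤ Y.card := by exact_mod_cast (Nat.le_add_left _ _).trans hcard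
  have h2 : (2 * |C| + 7 / 8 + ε) / ε ≤ Y.card :=
    (Nat.le_ceil _).trans (mod_cast (Nat.le_succ _).trans hcard)
  rw [div_le_iff₀ hε] at h2
  nlinarith [le_abs_self C, abs_nonneg C,
    mul_le_mul_of_nonneg_right h2 (zero_le_one.trans h1),
    mul_nonneg (abs_nonneg C) (sub_nonneg.2 h1)]
end

section
/- Let V ⊂ ℝ³ be a finite set in which no two distinct points agree in any coordinate, and define u ∼ v iff u ≠ v and every w ∈ V ∖ {u,v} satisfies w₁ > max(u₁,v₁) or w₂ > max(u₂,v₂) or w₃ ∉ [min(u₃,v₃), max(u₃,v₃)]. Let u, v ∈ V with u₁ < v₁ and u₃ < v₃, and let S = { w ∈ V : w ∼ u, w ∼ v, w₁ < u₁, w₂ > max(u₂, v₂) }. Then every w ∈ S satisfies w₃ > u₃, and at most one w ∈ S satisfies w₃ < v₃. -/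
open scoped Classical

/-- The edge relation (⋆) for graphs with a realizer of the form `{π₁, π₂, π₃, π̄₃}`:
`u ∼ v` iff `u ≠ v` and every other point `w` of `V` satisfies
`w₁ > max(u₁,v₁)` or `w₂ > max(u₂,v₂)` or `w₃ ∉ [min(u₃,v₃), max(u₃,v₃)]`. -/
def Rel3 (V : Finset (Fin 3 → ℝ)) (u v : Fin 3 → ℝ) : Prop :=
  u ≠ v ∧ ∀ w ∈ V, w ≠ u → w ≠ v →
    max (u 0) (v 0) < w 0 ∨ max (u 1) (v 1) < w 1 ∨
    w 2 ∉ Set.Icc (min (u 2) (v 2)) (max (u 2) (v 2))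

/-- Fact 3(a): for `u, v` with `u₁ < v₁` and `u₃ < v₃`, every common neighbor `w`
north-west of both satisfies `w₃ > u₃`, and at most one of them has `w₃ < v₃`. -/
theorem nw_common_neighbors (V : Finset (Fin 3 → ℝ))
    (hgen : ∀ p ∈ V, ∀ q ∈ V, p ≠ q → ∀ i, p i ≠ q i)
    (u v : Fin 3 → ℝ) (hu : u ∈ V) (hv : v ∈ V)
    (h1 : u 0 < v 0) (h3 : u 2 < v 2) :
    (∀ w ∈ V, Rel3 V w u → Rel3 V w v → w 0 < u 0 → max (u 1) (v 1) < w 1 →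
        u 2 < w 2) ∧
    (V.filter (fun w => Rel3 V w u ∧ Rel3 V w v ∧ w 0 < u 0 ∧
        max (u 1) (v 1) < w 1 ∧ w 2 < v 2)).card ≤ 1 := by
  have third_lt : ∀ w ∈ V, Rel3 V w u → Rel3 V w v → w 0 < u 0 → max (u 1) (v 1) < w 1 →
      u 2 < w 2 := by
    intro w _ hwu hwv hw0 hw1
    by_contra hle
    have huv : u ≠ v := fun h => h1.ne (congrFun h 0)
    rcases hwv.2 u hu hwu.1.symm huv with h | h | h
    · exact absurd (max_lt_iff.mp h).2 h1.not_gt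
    · exact absurd (max_lt_iff.mp h).1 ((le_max_left _ _).trans_lt hw1).not_gt
    · exact h ⟨min_le_of_left_le (not_lt.mp hle), le_max_of_le_right h3.le⟩
  have not_lt_third : ∀ w ∈ V, ∀ x ∈ V, Rel3 V w u → Rel3 V w v → Rel3 V x u → Rel3 V x v →
      w 0 < u 0 → x 0 < u 0 → u 2 < w 2 → x 2 < v 2 → ¬ w 2 < x 2 := by
    intro w hw x hx hwu hwv hxu hxv hw0 hx0 hw2 hx2 hlt
    have hne : w ≠ x := fun h => hlt.ne (congrFun h 2)
    have hxw : x 1 < w 1 := by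
      rcases hxu.2 w hw hne hwu.1 with h | h | h
      · exact absurd (max_lt_iff.mp h).2 hw0.not_gt
      · exact (max_lt_iff.mp h).1
      · exact absurd ⟨min_le_of_right_le hw2.le, le_max_of_le_left hlt.le⟩ h
    rcases hwv.2 x hx hne.symm hxv.1 with h | h | h
    · exact absurd (max_lt_iff.mp h).2 (hx0.trans h1).not_gt
    · exact absurd (max_lt_iff.mp h).1 hxw.not_gt
    · exact h ⟨min_le_of_left_le hlt.le, le_max_of_le_right hx2.le⟩
  refine ⟨third_lt, Finset.card_le_one.mpr ?_⟩
  intro w hw x hx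
  obtain ⟨hwV, hwu, hwv, hw0, hw1, hw2⟩ := Finset.mem_filter.mp hw
  obtain ⟨hxV, hxu, hxv, hx0, hx1, hx2⟩ := Finset.mem_filter.mp hx
  by_contra hne
  rcases lt_or_gt_of_ne (hgen w hwV x hxV hne 2) with h | h
  · exact not_lt_third w hwV x hxV hwu hwv hxu hxv hw0 hx0 (third_lt w hwV hwu hwv hw0 hw1) hx2 h
  · exact not_lt_third x hxV w hwV hxu hxv hwu hwv hx0 hw0 (third_lt x hxV hxu hxv hx0 hx1) hw2 h
end
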